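/- On the GCM graph of type A_n with n ≥ 1, let (a_1,…,a_n) be a strongly dominant position. Then the concatenated firing sequence (s_n, s_{n−1}, …, s_1), where s_i = (i, i+1, …, n−1, n) for 1 ≤ i ≤ n, is a legal firing sequence from (a_1,…,a_n), and the resulting position assigns −a_{n+1−j} to node j for 1 ≤ j ≤ n; that is, the resulting position is (−a_n, −a_{n−1}, …, −a_1). -/

import Mathlib

/-- Firing node `i` transforms the position `lam` by `lam j ↦ lam j - M i j * lam i`. -/
def fire (M : ℕ → ℕ → ℤ) (lam : ℕ → ℝ) (i : ℕ) : ℕ → ℝ :=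
  fun j => lam j - (M i j : ℝ) * lam i

/-- The position obtained from `lam` by firing the nodes of a list in order. -/
def fireList (M : ℕ → ℕ → ℤ) : (ℕ → ℝ) → List ℕ → (ℕ → ℝ)
  | lam, [] => lam
  | lam, i :: s => fireList M (fire M lam i) s

/-- A list of node firings is legal from `lam` (on the graph with node set `{1,…,n}`)
if each fired node is a node of the graph carrying a positive number at the time of firing. -/
def LegalSeq (n : ℕ) (M : ℕ → ℕ → ℤ) : (ℕ → ℝ) → List ℕ → Prop
  | _, [] => True
  | lam, i :: s => 1 ≤ i ∧ i ≤ n ∧ 0 < lam i ∧ LegalSeq n M (fire M lam i) s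

/-- The GCM of type `A n` on nodes `{1,…,n}` (extended by zero off the node set). -/
def MtypeA (n : ℕ) : ℕ → ℕ → ℤ := fun i j =>
  if i = j then 2
  else if 1 ≤ i ∧ i ≤ n ∧ 1 ≤ j ∧ j ≤ n ∧ (i + 1 = j ∨ j + 1 = i) then -1
  else 0

/-- The GCM of type `B n` on nodes `{1,…,n}`: as type `A n` except `M (n-1) n = -2`. -/
def MtypeB (n : ℕ) : ℕ → ℕ → ℤ := fun i j =>
  if i = j then 2
  else if 1 ≤ i ∧ i + 1 = j ∧ j ≤ n then (if j = n then -2 else -1)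
  else if 1 ≤ j ∧ j + 1 = i ∧ i ≤ n then -1
  else 0

/-- The GCM of type `C n` on nodes `{1,…,n}`: as type `A n` except `M n (n-1) = -2`. -/
def MtypeC (n : ℕ) : ℕ → ℕ → ℤ := fun i j =>
  if i = j then 2
  else if 1 ≤ i ∧ i + 1 = j ∧ j ≤ n then -1
  else if 1 ≤ j ∧ j + 1 = i ∧ i ≤ n then (if i = n then -2 else -1)
  else 0

/-- The GCM of type `D n` on nodes `{1,…,n}`: a path `1,…,n-1` together with the
edge `{n-2, n}`, all amplitudes `-1`. -/
def MtypeD (n : ℕ) : ℕ → ℕ → ℤ := fun i j =>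
  if i = j then 2
  else if (1 ≤ i ∧ i + 1 = j ∧ j ≤ n - 1) ∨ (1 ≤ j ∧ j + 1 = i ∧ i ≤ n - 1) then -1
  else if (i = n - 2 ∧ j = n) ∨ (j = n - 2 ∧ i = n) then -1
  else 0

/-- The firing sequence `(s_n, s_{n-1}, …, s_1)` of Lemma 2.2.A, where
`s_i = (i, i+1, …, n-1, n)`. -/
def seqA1 (n : ℕ) : List ℕ :=
  ((List.range' 1 n).reverse).flatMap fun i => List.range' i (n + 1 - i)

theorem fireList_append (M : ℕ → ℕ → ℤ) (s t : List ℕ) (lam : ℕ → ℝ) :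
    fireList M lam (s ++ t) = fireList M (fireList M lam s) t := by
  induction s generalizing lam with
  | nil => rfl
  | cons i s ih => exact ih _

theorem legalSeq_append (n : ℕ) (M : ℕ → ℕ → ℤ) (s t : List ℕ) (lam : ℕ → ℝ) :
    LegalSeq n M lam (s ++ t) ↔ LegalSeq n M lam s ∧ LegalSeq n M (fireList M lam s) t := by
  induction s generalizing lam with
  | nil => simp [LegalSeq, fireList]
  | cons i s ih => simp [LegalSeq, fireList, ih, and_assoc]

/-- The position `lam` is, on the nodes `1, …, n`, the difference sequence of `y`. -/
def IsDiff (n : ℕ) (lam y : ℕ → ℝ) : Prop :=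
  ∀ j, 1 ≤ j → j ≤ n → lam j = y j - y (j + 1)

/-- Firing node `i` in type `A n` swaps the entries `i` and `i + 1` of the sequence
whose differences give the position. -/
theorem IsDiff.fire {n i : ℕ} {lam y z : ℕ → ℝ} (h : IsDiff n lam y) (hi : 1 ≤ i) (hin : i ≤ n)
    (hz : z i = y (i + 1)) (hz' : z (i + 1) = y i)
    (hne : ∀ j, 1 ≤ j → j ≤ n + 1 → j ≠ i → j ≠ i + 1 → z j = y j) :
    IsDiff n (fire (MtypeA n) lam i) z := by
  intro j hj hjn
  have h1 := h i hi hin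
  have h2 := h j hj hjn
  unfold _root_.fire MtypeA
  rcases eq_or_ne i j with rfl | hij
  · simp only [if_true, h1, hz, hz']
    push_cast
    ring
  rcases eq_or_ne (i + 1) j with rfl | hij'
  · rw [if_neg hij, if_pos (by omega), hz', hne (i + 2) (by omega) (by omega) (by omega) (by omega),
      h1, h2]
    push_cast
    ring
  rcases eq_or_ne (j + 1) i with rfl | hji
  · rw [if_neg hij, if_pos (by omega), hz, hne j (by omega) (by omega) (by omega) (by omega), h1, h2]
    push_cast
    ring
  · rw [if_neg hij, if_neg (by omega), hne j (by omega) (by omega) (by omega) (by omega),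
      hne (j + 1) (by omega) (by omega) (by omega) (by omega), h2]
    push_cast
    ring

/-- The arrangement of `1, …, n + 1` reached in type `A n` after the firing of
`s_n, …, s_{k+1}` and then of the nodes `k, …, i - 1`. -/
def arrangement (n k i j : ℕ) : ℕ :=
  if j < k then j else if j < i then n + k + 1 - j else if j = i then k else n + k + 2 - j

theorem legalSeq_range' {n k : ℕ} {x : ℕ → ℝ} (hk : 1 ≤ k)
    (hx : ∀ p q, 1 ≤ p → p < q → q ≤ n + 1 → x q < x p) (m i : ℕ) (lam : ℕ → ℝ)
    (hki : k ≤ i) (hm : i + m = n + 1) (h : IsDiff n lam fun j => x (arrangement n k i j)) :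
    LegalSeq n (MtypeA n) lam (List.range' i m) ∧
      IsDiff n (fireList (MtypeA n) lam (List.range' i m))
        fun j => x (arrangement n k (n + 1) j) := by
  induction m generalizing i lam with
  | zero =>
    obtain rfl : i = n + 1 := by omega
    exact ⟨trivial, h⟩
  | succ m ih =>
    have hpos : 0 < lam i := by
      have e : arrangement n k i i = k := by unfold arrangement; grind
      have e' : arrangement n k i (i + 1) = n + k + 1 - i := by unfold arrangement; grind
      rw [h i (by omega) (by omega)]
      simp only [e, e', sub_pos]
      exact hx _ _ hk (by omega) (by omega)
    have hfire : IsDiff n (fire (MtypeA n) lam i) fun j => x (arrangement n k (i + 1) j) := by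
      refine h.fire (by omega) (by omega) (congrArg x ?_) (congrArg x ?_)
        fun j _ _ _ _ => congrArg x ?_
      all_goals unfold arrangement; grind
    obtain ⟨h1, h2⟩ := ih (i + 1) _ (by omega) (by omega) hfire
    exact ⟨⟨by omega, by omega, hpos, h1⟩, h2⟩

theorem legalSeq_flatMap_range' {n : ℕ} {x : ℕ → ℝ}
    (hx : ∀ p q, 1 ≤ p → p < q → q ≤ n + 1 → x q < x p) (k : ℕ) (lam : ℕ → ℝ)
    (hk : k ≤ n) (h : IsDiff n lam fun j => x (arrangement n (k + 1) (n + 1) j)) :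
    LegalSeq n (MtypeA n) lam
        ((List.range' 1 k).reverse.flatMap fun i => List.range' i (n + 1 - i)) ∧
      IsDiff n (fireList (MtypeA n) lam
        ((List.range' 1 k).reverse.flatMap fun i => List.range' i (n + 1 - i)))
        fun j => x (arrangement n 1 (n + 1) j) := by
  induction k generalizing lam with
  | zero => exact ⟨trivial, h⟩
  | succ k ih =>
    have hstart : IsDiff n lam fun j => x (arrangement n (k + 1) (k + 1) j) := by
      intro j hj hjn
      rw [h j hj hjn]
      congr 2 <;> unfold arrangement <;> grind
    obtain ⟨h1, h2⟩ := legalSeq_range' (by omega) hx (n + 1 - (k + 1)) (k + 1) lam le_rfl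
      (by omega) hstart
    obtain ⟨h3, h4⟩ := ih _ (by omega) h2
    rw [List.range'_1_concat, List.reverse_append, List.reverse_singleton, List.singleton_append,
      List.flatMap_cons, legalSeq_append, fireList_append, add_comm 1 k]
    exact ⟨⟨h1, h3⟩, h4⟩

/-- On type `A n` (`n ≥ 1`), from a strongly dominant position `(a 1, …, a n)` the
firing sequence `(s_n, …, s_1)` with `s_i = (i, i+1, …, n)` is legal and yields the
position `(-a n, -a (n-1), …, -a 1)`. -/
theorem typeA_from1 (n : ℕ) (hn : 1 ≤ n) (a : ℕ → ℝ)
    (ha : ∀ i, 1 ≤ i → i ≤ n → 0 < a i) :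
    LegalSeq n (MtypeA n) a (seqA1 n) ∧
    ∀ j, 1 ≤ j → j ≤ n → fireList (MtypeA n) a (seqA1 n) j = -(a (n + 1 - j)) := by
  have hx : ∀ p q, 1 ≤ p → p < q → q ≤ n + 1 →
      -∑ i ∈ Finset.range q, a i < -∑ i ∈ Finset.range p, a i := by
    intro p q hp hpq hq
    induction q, hpq using Nat.le_induction with
    | base =>
      rw [Finset.sum_range_succ]
      linarith [ha p hp (by omega)]
    | succ q hpq ih =>
      rw [Finset.sum_range_succ]
      linarith [ha q (by omega) (by omega), ih (by omega)]
  have hstart : IsDiff n a fun j => -∑ i ∈ Finset.range (arrangement n (n + 1) (n + 1) j), a i := by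
    intro j hj hjn
    have e : arrangement n (n + 1) (n + 1) j = j := by unfold arrangement; grind
    have e' : arrangement n (n + 1) (n + 1) (j + 1) = j + 1 := by unfold arrangement; grind
    simp only [e, e', Finset.sum_range_succ]
    ring
  obtain ⟨h1, h2⟩ := legalSeq_flatMap_range' (x := fun p => -∑ i ∈ Finset.range p, a i)
    hx n a le_rfl hstart
  refine ⟨h1, fun j hj hjn => (h2 j hj hjn).trans ?_⟩
  have e : arrangement n 1 (n + 1) j = n + 1 - j + 1 := by unfold arrangement; grind
  have e' : arrangement n 1 (n + 1) (j + 1) = n + 1 - j := by unfold arrangement; grind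
  simp only [e, e', Finset.sum_range_succ]
  ring
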